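/- arXiv:1510.07824 — 8 statements merged into one kernel-verified Lean document; each statement's English description precedes it below -/
import Mathlib

section
/- Let n ≥ 1, let σ₁, …, σₙ be complex numbers with Re σₖ < 0 for each k, and let α₁, …, αₙ be complex numbers with Σₖ αₖ = 0. Then the integral ∫₀^∞ (1/r) Σₖ αₖ (σₖ e^{σₖ r} - e^{σₖ r}/r) dr converges and equals -Σₖ αₖ σₖ. -/
open MeasureTheory

/-- For `n ≥ 1`, complex `σₖ` with `Re σₖ < 0` and complex `αₖ` with
`Σ αₖ = 0`, the integral `∫₀^∞ (1/r) Σₖ αₖ (σₖ e^{σₖ r} - e^{σₖ r}/r) dr` converges and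
equals `-Σₖ αₖ σₖ`. -/
theorem stmt2 (n : ℕ) (hn : 1 ≤ n) (σ α : Fin n → ℂ)
    (hσ : ∀ k, (σ k).re < 0) (hα : ∑ k, α k = 0) :
    IntegrableOn
      (fun r : ℝ => (1 / (r : ℂ)) *
        ∑ k, α k * (σ k * Complex.exp (σ k * r) - Complex.exp (σ k * r) / r))
      (Set.Ioi 0) ∧
    (∫ r in Set.Ioi (0 : ℝ), (1 / (r : ℂ)) *
        ∑ k, α k * (σ k * Complex.exp (σ k * r) - Complex.exp (σ k * r) / r))
      = -∑ k, α k * σ k := by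
  set g : ℂ → ℂ := fun z => ∑ k, α k * Complex.exp (σ k * z) with hg
  have hg' : ∀ z, HasDerivAt g (∑ k, α k * (σ k * Complex.exp (σ k * z))) z := by
    intro z
    apply HasDerivAt.fun_sum
    intro k _
    apply HasDerivAt.const_mul
    have h := ((hasDerivAt_id z).const_mul (σ k)).cexp
    simpa [mul_comm] using h
  have hg0 : g 0 = 0 := by simp [hg, hα]
  set G : ℂ → ℂ := dslope g 0 with hG
  have hGd : Differentiable ℂ G := by
    have : DifferentiableOn ℂ G Set.univ :=
      (Complex.differentiableOn_dslope Filter.univ_mem).2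
        (fun z _ => (hg' z).differentiableAt.differentiableWithinAt)
    exact differentiableOn_univ.1 this
  have hG0 : G 0 = ∑ k, α k * σ k := by
    rw [hG, dslope_same, (hg' 0).deriv]; simp
  have hGne : ∀ z, z ≠ 0 → G z = g z / z := by
    intro z hz
    rw [hG, dslope_of_ne _ hz, slope_def_field, hg0]; simp
  set f : ℝ → ℂ := fun r : ℝ => (1 / (r : ℂ)) *
        ∑ k, α k * (σ k * Complex.exp (σ k * r) - Complex.exp (σ k * r) / r) with hf
  have hder : ∀ r : ℝ, r ∈ Set.Ioi (0:ℝ) → deriv G r = f r := by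
    intro r hr
    have hr0 : (r : ℂ) ≠ 0 := by exact_mod_cast (ne_of_gt hr)
    have h1 : G =ᶠ[nhds (r:ℂ)] fun z => g z / z := by
      filter_upwards [isOpen_ne.mem_nhds hr0] with z hz using hGne z hz
    rw [h1.deriv_eq, ((hg' r).fun_div (hasDerivAt_id' (r:ℂ)) hr0).deriv]
    simp only [hf, hg, mul_sub, Finset.sum_sub_distrib, Finset.sum_mul, ← mul_div_assoc,
      ← Finset.sum_div]
    field_simp
    simp [Finset.mul_sum, mul_comm, mul_left_comm]
    exact Finset.sum_congr rfl fun k _ => by ring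
  have hcont : Continuous (fun r : ℝ => deriv G r) :=
    (hGd.contDiff (n := 1)).continuous_deriv le_rfl |>.comp Complex.continuous_ofReal
  have hexp : ∀ k (r : ℝ), ‖Complex.exp (σ k * r)‖ = Real.exp ((σ k).re * r) := by
    intro k r
    rw [Complex.norm_exp]; simp
  have hint0 : IntegrableOn (fun r : ℝ => deriv G r) (Set.Ioi 0) := by
    rw [← Set.Ioc_union_Ioi_eq_Ioi (zero_le_one (α := ℝ))]
    apply IntegrableOn.union
    · exact (hcont.integrableOn_Icc (a := 0) (b := 1)).mono_set Set.Ioc_subset_Icc_self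
    · have hb : IntegrableOn (fun r : ℝ => ∑ k, ‖α k‖ * (‖σ k‖ + 1) * Real.exp ((σ k).re * r))
          (Set.Ioi 1) := by
        apply integrable_finsetSum
        intro k _
        exact (integrableOn_exp_mul_Ioi (hσ k) 1).const_mul _
      refine Integrable.mono' hb hcont.aestronglyMeasurable ?_
      filter_upwards [ae_restrict_mem measurableSet_Ioi] with r hr
      have hr1 : (1:ℝ) < r := hr
      rw [hder r (lt_trans zero_lt_one hr1)]
      have hi : ‖(r:ℂ)‖⁻¹ ≤ 1 := by
        rw [Complex.norm_real, Real.norm_of_nonneg (by linarith)]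
        exact inv_le_one_of_one_le₀ hr1.le
      simp only [hf, norm_mul, one_div, norm_inv]
      refine (mul_le_of_le_one_left (norm_nonneg _) hi).trans ?_
      refine (norm_sum_le _ _).trans (Finset.sum_le_sum fun k _ => ?_)
      rw [norm_mul, mul_assoc]
      refine mul_le_mul_of_nonneg_left ?_ (norm_nonneg _)
      refine (norm_sub_le _ _).trans ?_
      rw [norm_mul, norm_div, hexp, add_mul, one_mul, div_eq_mul_inv]
      gcongr
      exact mul_le_of_le_one_right (Real.exp_pos _).le hi
  have hlim : Filter.Tendsto (fun r : ℝ => G r) Filter.atTop (nhds 0) := by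
    have h1 : Filter.Tendsto (fun r : ℝ => g r * ((r⁻¹ : ℝ) : ℂ)) Filter.atTop (nhds (0 * ((0:ℝ):ℂ))) := by
      apply Filter.Tendsto.mul
      · have : (0:ℂ) = ∑ k, α k * 0 := by simp
        rw [this]
        refine tendsto_finsetSum _ fun k _ => Filter.Tendsto.const_mul _ ?_
        rw [tendsto_zero_iff_norm_tendsto_zero]
        simp only [hexp]
        exact Real.tendsto_exp_atBot.comp (Filter.tendsto_id.const_mul_atTop_of_neg (hσ k))
      · exact (Complex.continuous_ofReal.tendsto 0).comp tendsto_inv_atTop_zero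
    simp only [zero_mul] at h1
    refine h1.congr' ?_
    filter_upwards [Filter.eventually_gt_atTop 0] with r hr
    rw [hGne r (by exact_mod_cast hr.ne'), div_eq_mul_inv, Complex.ofReal_inv]
  refine ⟨hint0.congr_fun hder measurableSet_Ioi, ?_⟩
  rw [← setIntegral_congr_fun measurableSet_Ioi hder,
    integral_Ioi_of_hasDerivAt_of_tendsto' (f := fun r : ℝ => G r) (m := 0)
      (fun x _ => (hGd (x:ℂ)).hasDerivAt.comp_ofReal) hint0 hlim]
  simp [hG0]
end

section
/- Let T⁻¹(r,s) denote the kernel T⁻¹(r,s) = r²/(3s) for 0 < r ≤ s and T⁻¹(r,s) = s²/(3r) for 0 < s ≤ r. Then for every continuous function f with compact support contained in (0, ∞), the function u(r) = ∫₀^∞ T⁻¹(r,s) f(s) ds is twice continuously differentiable on (0, ∞) and satisfies -u''(r) + 2u(r)/r² = f(r) for all r > 0. -/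
open MeasureTheory

/-- The kernel `T⁻¹(r,s) = r²/(3s)` for `r ≤ s` and `s²/(3r)` for `s ≤ r`. -/
noncomputable def Tinv (r s : ℝ) : ℝ := if r ≤ s then r ^ 2 / (3 * s) else s ^ 2 / (3 * r)

lemma Tinv_aux_cont (f : ℝ → ℝ) (hf : Continuous f) (hpos : tsupport f ⊆ Set.Ioi 0) :
    Continuous (fun s => f s * s⁻¹) := by
  apply continuous_of_tsupport
  intro x hx
  have hx' : x ∈ tsupport f := (tsupport_mul_subset_left (f := f) (g := fun s => s⁻¹)) hx
  have h0 : (0 : ℝ) < x := hpos hx'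
  exact hf.continuousAt.mul (continuousAt_inv₀ h0.ne')

lemma Tinv_aux_formula (f : ℝ → ℝ) (hf : Continuous f) (hsupp : HasCompactSupport f)
    (hpos : tsupport f ⊆ Set.Ioi 0) (r : ℝ) (hr : 0 < r) :
    ∫ s in Set.Ioi (0 : ℝ), Tinv r s * f s =
      (∫ s in (0 : ℝ)..r, f s * s ^ 2) / (3 * r) +
        r ^ 2 / 3 * ((∫ s in Set.Ioi (0 : ℝ), f s * s⁻¹) - ∫ s in (0 : ℝ)..r, f s * s⁻¹) := by
  have hg := Tinv_aux_cont f hf hpos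
  have hgi : Integrable (fun s => f s * s⁻¹) :=
    hg.integrable_of_hasCompactSupport (hsupp.mul_right (f' := fun s => s⁻¹))
  have hh : Continuous (fun s => f s * s ^ 2) := by fun_prop
  have hhi : Integrable (fun s => f s * s ^ 2) :=
    hh.integrable_of_hasCompactSupport (hsupp.mul_right (f' := fun s => s ^ 2))
  have hU : Set.Ioi (0 : ℝ) = Set.Ioc 0 r ∪ Set.Ioi r := (Set.Ioc_union_Ioi_eq_Ioi hr.le).symm
  have hd : Disjoint (Set.Ioc 0 r) (Set.Ioi r) := Set.Ioc_disjoint_Ioi le_rfl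
  have e1 : Set.EqOn (fun s => (f s * s ^ 2) / (3 * r)) (fun s => Tinv r s * f s)
      (Set.Ioc 0 r) := by
    intro s hs
    have := hs.1
    simp only [Tinv]
    split_ifs with h
    · have : s = r := le_antisymm hs.2 h
      subst this
      field_simp
    · field_simp
  have e2 : Set.EqOn (fun s => r ^ 2 / 3 * (f s * s⁻¹)) (fun s => Tinv r s * f s)
      (Set.Ioi r) := by
    intro s hs
    have h1 : r < s := hs
    have : 0 < s := hr.trans h1
    simp only [Tinv, if_pos h1.le]
    field_simp
  have i1 : IntegrableOn (fun s => Tinv r s * f s) (Set.Ioc 0 r) :=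
    ((hhi.div_const (3 * r)).integrableOn).congr_fun e1 measurableSet_Ioc
  have i2 : IntegrableOn (fun s => Tinv r s * f s) (Set.Ioi r) :=
    ((hgi.const_mul (r ^ 2 / 3)).integrableOn).congr_fun e2 measurableSet_Ioi
  have s1 : ∫ s in Set.Ioi (0 : ℝ), f s * s⁻¹ =
      (∫ s in Set.Ioc 0 r, f s * s⁻¹) + ∫ s in Set.Ioi r, f s * s⁻¹ := by
    rw [hU, setIntegral_union hd measurableSet_Ioi hgi.integrableOn hgi.integrableOn]
  rw [s1, hU, setIntegral_union hd measurableSet_Ioi i1 i2,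
    ← setIntegral_congr_fun measurableSet_Ioc e1, ← setIntegral_congr_fun measurableSet_Ioi e2,
    integral_div, integral_const_mul, intervalIntegral.integral_of_le hr.le,
    intervalIntegral.integral_of_le hr.le]
  ring

/-- For every continuous `f` with compact support contained in `(0, ∞)`,
the function `u(r) = ∫₀^∞ T⁻¹(r,s) f(s) ds` is twice continuously differentiable on
`(0, ∞)` and satisfies `-u'' + 2u/r² = f` there. -/
theorem stmt4 (f : ℝ → ℝ) (hf : Continuous f) (hsupp : HasCompactSupport f)
    (hpos : tsupport f ⊆ Set.Ioi 0) :
    ContDiffOn ℝ 2 (fun r => ∫ s in Set.Ioi (0 : ℝ), Tinv r s * f s) (Set.Ioi 0) ∧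
    ∀ r ∈ Set.Ioi (0 : ℝ),
      -deriv (deriv (fun t => ∫ s in Set.Ioi (0 : ℝ), Tinv t s * f s)) r
        + 2 * (∫ s in Set.Ioi (0 : ℝ), Tinv r s * f s) / r ^ 2 = f r := by
  have hg := Tinv_aux_cont f hf hpos
  have hh : Continuous (fun s => f s * s ^ 2) := by fun_prop
  have hform := Tinv_aux_formula f hf hsupp hpos
  set u : ℝ → ℝ := fun t => ∫ s in Set.Ioi (0 : ℝ), Tinv t s * f s with hu
  set C : ℝ := ∫ s in Set.Ioi (0 : ℝ), f s * s⁻¹ with hC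
  obtain ⟨H, hHdef⟩ : ∃ H : ℝ → ℝ, H = fun r => ∫ s in (0 : ℝ)..r, f s * s ^ 2 := ⟨_, rfl⟩
  obtain ⟨G, hGdef⟩ : ∃ G : ℝ → ℝ, G = fun r => C - ∫ s in (0 : ℝ)..r, f s * s⁻¹ := ⟨_, rfl⟩
  have dH : ∀ r, HasDerivAt H (f r * r ^ 2) r := by
    intro r
    rw [hHdef]
    exact hh.integral_hasStrictDerivAt 0 r |>.hasDerivAt
  have dG : ∀ r, HasDerivAt G (-(f r * r⁻¹)) r := by
    intro r
    rw [hGdef]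
    exact (hg.integral_hasStrictDerivAt 0 r |>.hasDerivAt).const_sub C
  have hform' : ∀ r, 0 < r → u r = H r / (3 * r) + r ^ 2 / 3 * G r := by
    intro r hr
    rw [hHdef, hGdef]
    exact hform r hr
  have du : ∀ r, 0 < r → HasDerivAt u (-(H r) / (3 * r ^ 2) + 2 * r / 3 * G r) r := by
    intro r hr
    have h1 := ((dH r).div ((hasDerivAt_id r).const_mul 3) (by simp [hr.ne'])).add
      ((((hasDerivAt_id r).pow 2).div_const 3).mul (dG r))
    have h2 : HasDerivAt u _ r := h1.congr_of_eventuallyEq (by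
      filter_upwards [lt_mem_nhds hr] with t ht
      simp [hform' t ht])
    convert h2 using 1
    simp
    field_simp
    ring
  have ddu : ∀ r, 0 < r → HasDerivAt (deriv u)
      (2 * H r / (3 * r ^ 3) + 2 / 3 * G r - f r) r := by
    intro r hr
    have h1 := ((dH r).neg.div (((hasDerivAt_id r).pow 2).const_mul 3) (by simp [hr.ne'])).add
      ((((hasDerivAt_id r).const_mul 2).div_const 3).mul (dG r))
    have h2 : HasDerivAt (deriv u) _ r := h1.congr_of_eventuallyEq (by
      filter_upwards [lt_mem_nhds hr] with t ht
      simp [(du t ht).deriv])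
    convert h2 using 1
    simp
    field_simp
    ring
  have cH : Continuous H := continuous_iff_continuousAt.2 fun r => (dH r).continuousAt
  have cG : Continuous G := continuous_iff_continuousAt.2 fun r => (dG r).continuousAt
  constructor
  · have c2 : ContinuousOn (deriv (deriv u)) (Set.Ioi 0) := by
      have : ContinuousOn (fun r => 2 * H r / (3 * r ^ 3) + 2 / 3 * G r - f r) (Set.Ioi 0) := by
        have : ∀ r ∈ Set.Ioi (0 : ℝ), 3 * r ^ 3 ≠ 0 := by
          intro r hr
          have : (0 : ℝ) < r := hr
          positivity
        fun_prop (disch := assumption)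
      exact this.congr fun r hr => (ddu r hr).deriv
    have c1 : ContDiffOn ℝ 1 (deriv u) (Set.Ioi 0) := by
      rw [show (1 : WithTop ℕ∞) = 0 + 1 from rfl, contDiffOn_succ_iff_deriv_of_isOpen isOpen_Ioi]
      exact ⟨fun r hr => (ddu r hr).differentiableAt.differentiableWithinAt,
        by simp, contDiffOn_zero.2 c2⟩
    rw [show (2 : WithTop ℕ∞) = 1 + 1 from rfl, contDiffOn_succ_iff_deriv_of_isOpen isOpen_Ioi]
    exact ⟨fun r hr => (du r hr).differentiableAt.differentiableWithinAt, by simp, c1⟩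
  · intro r hr
    have hr' : (0 : ℝ) < r := hr
    change -deriv (deriv u) r + 2 * u r / r ^ 2 = f r
    rw [(ddu r hr').deriv, hform' r hr']
    field_simp
    ring
end

section
/- Fix κ ∈ ℝ. Let u and v be real-valued functions of class C⁴ on [0, ∞), compactly supported, with u(0) = v(0) = 0, satisfying the boundary conditions 3u''(0) = 4κ u'(0) and 3v''(0) = 4κ v'(0). Define (T_κ w)(r) = -w''(r) + 2w(r)/r² - (2/r) w'(0). Then the integrals ⟨u, T_κ v⟩ = ∫₀^∞ (u'(r)(T_κ v)'(r) + 2u(r)(T_κ v)(r)/r²) dr and ⟨T_κ u, v⟩ converge and ⟨u, T_κ v⟩ = ⟨T_κ u, v⟩. -/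
open MeasureTheory

/-- The (right-sided) derivative on `[0, ∞)`. -/
noncomputable def Dr (u : ℝ → ℝ) : ℝ → ℝ := derivWithin u (Set.Ici 0)

/-- The extended operation `T_κ w = -w'' + 2w/r² - (2/r) w'(0)`. -/
noncomputable def Tkappa (w : ℝ → ℝ) : ℝ → ℝ :=
  fun r => -(Dr (Dr w) r) + 2 * w r / r ^ 2 - (2 / r) * Dr w 0

/-- Remainder estimate: one integration step. -/
lemma step_bound (f f' : ℝ → ℝ) (C R : ℝ) (n : ℕ) (hC : 0 ≤ C)
    (hf : ∀ x, 0 ≤ x → HasDerivWithinAt f (f' x) (Set.Ici 0) x) (h0 : f 0 = 0)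
    (hb : ∀ x, 0 ≤ x → x ≤ R → |f' x| ≤ C * x ^ n) :
    ∀ x, 0 ≤ x → x ≤ R → |f x| ≤ C * x ^ (n + 1) := by
  intro x hx hxR
  have := Convex.norm_image_sub_le_of_norm_hasDerivWithin_le (f := f) (f' := f') (s := Set.Icc 0 x)
    (C := C * x ^ n) (x := 0) (y := x)
    (fun y hy => (hf y hy.1).mono Set.Icc_subset_Ici_self)
    (fun y hy => by
      refine (hb y hy.1 (hy.2.trans hxR)).trans ?_
      have := pow_le_pow_left₀ hy.1 hy.2 n
      gcongr)
    (convex_Icc 0 x) ⟨le_refl _, hx⟩ ⟨hx, le_refl _⟩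
  rw [h0, sub_zero, sub_zero, Real.norm_eq_abs, Real.norm_eq_abs, abs_of_nonneg hx] at this
  calc |f x| ≤ _ := this
    _ = _ := by ring

/-- Data extracted from a function. -/
structure Good (v v1 v2 v3 : ℝ → ℝ) (R : ℝ) : Prop where
  h0 : v 0 = 0
  d0 : ∀ x, 0 ≤ x → HasDerivWithinAt v (v1 x) (Set.Ici 0) x
  d1 : ∀ x, 0 ≤ x → HasDerivWithinAt v1 (v2 x) (Set.Ici 0) x
  d2 : ∀ x, 0 ≤ x → HasDerivWithinAt v2 (v3 x) (Set.Ici 0) x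
  c3 : ContinuousOn v3 (Set.Ici 0)
  z : ∀ x, R < x → v x = 0
  z1 : ∀ x, R < x → v1 x = 0
  z2 : ∀ x, R < x → v2 x = 0

lemma good_of (v : ℝ → ℝ) (hv : ContDiffOn ℝ 4 v (Set.Ici 0)) (hvs : HasCompactSupport v)
    (hv0 : v 0 = 0) : ∃ R₀, 0 < R₀ ∧ ∀ R, R₀ ≤ R →
      Good v (Dr v) (Dr (Dr v)) (Dr (Dr (Dr v))) R := by
  have hU := uniqueDiffOn_Ici (0 : ℝ)
  have e1 : ContDiffOn ℝ 3 (Dr v) (Set.Ici 0) := hv.derivWithin hU (by norm_num)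
  have e2 : ContDiffOn ℝ 2 (Dr (Dr v)) (Set.Ici 0) := e1.derivWithin hU (by norm_num)
  have e3 : ContDiffOn ℝ 1 (Dr (Dr (Dr v))) (Set.Ici 0) := e2.derivWithin hU (by norm_num)
  obtain ⟨R, hR⟩ := hvs.isCompact.isBounded.subset_closedBall (0 : ℝ)
  have hz : ∀ x, R < x → v x = 0 := by
    intro x hx
    by_contra h
    have := hR (subset_tsupport v h)
    rw [Metric.mem_closedBall, Real.dist_eq, sub_zero] at this
    linarith [le_abs_self x]
  have key : ∀ (R : ℝ) (w : ℝ → ℝ), 0 < R → (∀ x, R < x → w x = 0) → ∀ x, R < x → Dr w x = 0 := by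
    intro R w hR0 hw x hx
    have hE : w =ᶠ[nhds x] fun _ => 0 := by
      filter_upwards [Ioi_mem_nhds hx] with y hy using hw y hy
    unfold Dr
    rw [derivWithin_of_mem_nhds (Ici_mem_nhds (hR0.trans hx)), hE.deriv_eq]
    simp
  refine ⟨max R 1, by positivity, fun R' hR' => ?_⟩
  have hR1 : R ≤ R' := (le_max_left _ _).trans hR'
  have hR2 : 0 < R' := lt_of_lt_of_le (by positivity) hR'
  have z0 : ∀ x, R' < x → v x = 0 := fun x hx => hz x (lt_of_le_of_lt hR1 hx)
  have z1 := key R' v hR2 z0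
  have z2 := key R' _ hR2 z1
  exact ⟨hv0, fun x hx => (hv.differentiableOn (by norm_num) x hx).hasDerivWithinAt,
    fun x hx => (e1.differentiableOn (by norm_num) x hx).hasDerivWithinAt,
    fun x hx => (e2.differentiableOn (by norm_num) x hx).hasDerivWithinAt,
    e3.continuousOn, z0, z1, z2⟩

/-- `T v` -/
noncomputable def TT (v v2 : ℝ → ℝ) (a : ℝ) (r : ℝ) : ℝ := -(v2 r) + 2 * v r / r ^ 2 - (2 / r) * a
/-- derivative of the previous function -/
noncomputable def TD (v v1 v3 : ℝ → ℝ) (a : ℝ) (r : ℝ) : ℝ :=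
  -(v3 r) + 2 * v1 r / r ^ 2 - 4 * v r / r ^ 3 + 2 * a / r ^ 2
/-- primitive of `T v / r` -/
noncomputable def GG (v v1 : ℝ → ℝ) (a : ℝ) (r : ℝ) : ℝ := -(v1 r) / r - v r / r ^ 2 + 2 * a / r

lemma Good.bounds {v v1 v2 v3 : ℝ → ℝ} {R : ℝ} (g : Good v v1 v2 v3 R) :
    ∃ K, 0 ≤ K ∧ ∀ r, 0 < r → r ≤ R →
      |v1 r| ≤ K ∧ |v r| ≤ K * r ∧ |TT v v2 (v1 0) r| ≤ 3 * K * r ∧ |TD v v1 v3 (v1 0) r| ≤ 7 * K ∧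
      |GG v v1 (v1 0) r + 3 / 2 * v2 0| ≤ 2 * K * r := by
  obtain ⟨C3, h3⟩ := (isCompact_Icc (a := (0:ℝ)) (b := R)).exists_bound_of_continuousOn
    (g.c3.mono Set.Icc_subset_Ici_self)
  have c1 : ContinuousOn v1 (Set.Ici 0) := fun x hx => (g.d1 x hx).continuousWithinAt
  obtain ⟨C1, h1⟩ := (isCompact_Icc (a := (0:ℝ)) (b := R)).exists_bound_of_continuousOn
    (c1.mono Set.Icc_subset_Ici_self)
  obtain ⟨K, hK, hK1, hK3⟩ : ∃ K, 0 ≤ K ∧ C1 ≤ K ∧ C3 ≤ K :=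
    ⟨max 0 (max C1 C3), by simp, by simp, by simp⟩
  have b3 : ∀ x, 0 ≤ x → x ≤ R → |v3 x| ≤ K * x ^ 0 := fun x hx hxR => by
    simpa using (h3 x ⟨hx, hxR⟩).trans hK3
  have b1 : ∀ x, 0 ≤ x → x ≤ R → |v1 x| ≤ K * x ^ 0 := fun x hx hxR => by
    simpa using (h1 x ⟨hx, hxR⟩).trans hK1
  have p2 := step_bound (fun x => v2 x - v2 0) v3 K R 0 hK
    (fun x hx => (g.d2 x hx).sub_const _) (by simp) b3
  have p1 := step_bound (fun x => v1 x - v2 0 * x - v1 0) (fun x => v2 x - v2 0) K R 1 hK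
    (fun x hx => by
      simpa using ((g.d1 x hx).sub ((hasDerivWithinAt_id x _).const_mul (v2 0))).sub_const (v1 0))
    (by simp) p2
  have p0 := step_bound (fun x => v x - v2 0 * x ^ 2 / 2 - v1 0 * x)
    (fun x => v1 x - v2 0 * x - v1 0) K R 2 hK
    (fun x hx => by
      have := ((g.d0 x hx).sub ((((hasDerivWithinAt_id x (Set.Ici 0)).pow 2).const_mul
        (v2 0)).div_const 2)).sub ((hasDerivWithinAt_id x _).const_mul (v1 0))
      refine this.congr_deriv ?_
      simp
      ring)
    (by simp [g.h0]) p1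
  have q0 := step_bound v v1 K R 0 hK g.d0 g.h0 b1
  refine ⟨K, hK, fun r hr hrR => ?_⟩
  have hr0 : r ≠ 0 := hr.ne'
  have P2 := p2 r hr.le hrR
  have P1 := p1 r hr.le hrR
  have P0 := p0 r hr.le hrR
  have Q0 := q0 r hr.le hrR
  have B3 := b3 r hr.le hrR
  have B1 := b1 r hr.le hrR
  simp only [zero_add, pow_one, pow_zero, mul_one] at P2 P1 P0 Q0 B3 B1
  norm_num at P1 P0
  have s0 : v r = (v r - v2 0 * r ^ 2 / 2 - v1 0 * r) + v2 0 * r ^ 2 / 2 + v1 0 * r := by ring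
  have s1 : v1 r = (v1 r - v2 0 * r - v1 0) + v2 0 * r + v1 0 := by ring
  generalize (v r - v2 0 * r ^ 2 / 2 - v1 0 * r) = X0 at *
  generalize (v1 r - v2 0 * r - v1 0) = X1 at *
  have s2 : v2 r = (v2 r - v2 0) + v2 0 := by ring
  generalize v2 r - v2 0 = X2 at *
  obtain ⟨Y0, rfl⟩ : ∃ Y, X0 = Y * r ^ 3 := ⟨X0 / r ^ 3, by field_simp⟩
  obtain ⟨Y1, rfl⟩ : ∃ Y, X1 = Y * r ^ 2 := ⟨X1 / r ^ 2, by field_simp⟩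
  obtain ⟨Y2, rfl⟩ : ∃ Y, X2 = Y * r := ⟨X2 / r, by field_simp⟩
  rw [abs_mul, abs_of_pos (by positivity : (0:ℝ) < r ^ 3)] at P0
  rw [abs_mul, abs_of_pos (by positivity : (0:ℝ) < r ^ 2)] at P1
  rw [abs_mul, abs_of_pos hr] at P2
  replace P0 := abs_le.1 (le_of_mul_le_mul_right P0 (by positivity))
  replace P1 := abs_le.1 (le_of_mul_le_mul_right P1 (by positivity))
  replace P2 := abs_le.1 (le_of_mul_le_mul_right P2 (by positivity))
  have B3' := abs_le.1 B3
  refine ⟨B1, Q0, ?_, ?_, ?_⟩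
  · have : TT v v2 (v1 0) r = (-Y2 + 2 * Y0) * r := by
      unfold TT; rw [s0, s2]; field_simp; ring
    rw [this, abs_mul, abs_of_pos hr]
    gcongr
    rw [abs_le]; constructor <;> linarith
  · have : TD v v1 v3 (v1 0) r = -v3 r + 2 * Y1 - 4 * Y0 := by
      unfold TD; rw [s0, s1]; field_simp; ring
    rw [this, abs_le]; constructor <;> linarith
  · have : GG v v1 (v1 0) r + 3 / 2 * v2 0 = (-Y1 - Y0) * r := by
      unfold GG; rw [s0, s1]; field_simp; ring
    rw [this, abs_mul, abs_of_pos hr]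
    gcongr
    rw [abs_le]; constructor <;> linarith

lemma hasDeriv_TT {v v1 v2 v3 : ℝ → ℝ} {R : ℝ} (g : Good v v1 v2 v3 R) (a r : ℝ) (hr : 0 < r) :
    HasDerivAt (TT v v2 a) (TD v v1 v3 a r) r := by
  have hm := Ici_mem_nhds hr
  have d0 := (g.d0 r hr.le).hasDerivAt hm
  have d2 := (g.d2 r hr.le).hasDerivAt hm
  have hr0 : r ≠ 0 := hr.ne'
  have := (d2.neg.add ((d0.const_mul 2).div (hasDerivAt_pow 2 r) (by positivity))).sub
    (((hasDerivAt_const r (2:ℝ)).div (hasDerivAt_id r) hr0).mul_const a)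
  refine this.congr_deriv ?_
  unfold TD
  simp
  field_simp
  ring

lemma hasDeriv_GG {v v1 v2 v3 : ℝ → ℝ} {R : ℝ} (g : Good v v1 v2 v3 R) (a r : ℝ) (hr : 0 < r) :
    HasDerivAt (GG v v1 a) (TT v v2 a r / r) r := by
  have hm := Ici_mem_nhds hr
  have d0 := (g.d0 r hr.le).hasDerivAt hm
  have d1 := (g.d1 r hr.le).hasDerivAt hm
  have hr0 : r ≠ 0 := hr.ne'
  have := ((d1.neg.div (hasDerivAt_id r) hr0).sub (d0.div (hasDerivAt_pow 2 r) (by positivity))).add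
    ((hasDerivAt_const r (2 * a)).div (hasDerivAt_id r) hr0)
  refine this.congr_deriv ?_
  unfold TT
  simp
  field_simp
  ring

/-- explicit integrand -/
noncomputable def EE (u u1 v v1 v2 v3 : ℝ → ℝ) (a : ℝ) (r : ℝ) : ℝ :=
  u1 r * TD v v1 v3 a r + 2 * u r * TT v v2 a r / r ^ 2

lemma integrable_EE {u u1 u2 u3 v v1 v2 v3 : ℝ → ℝ} {R : ℝ} (hR : 0 < R)
    (gu : Good u u1 u2 u3 R) (gv : Good v v1 v2 v3 R) :
    IntegrableOn (EE u u1 v v1 v2 v3 (v1 0)) (Set.Ioi 0) := by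
  have hs : Set.Ioi (0:ℝ) = Set.Ioc 0 R ∪ Set.Ioi R := (Set.Ioc_union_Ioi_eq_Ioi hR.le).symm
  rw [hs]
  refine IntegrableOn.union ?_ ?_
  · obtain ⟨M, hM, hu⟩ := gu.bounds
    obtain ⟨K, hK, hv⟩ := gv.bounds
    have hsub : Set.Ioc 0 R ⊆ Set.Ici (0:ℝ) := fun x hx => hx.1.le
    have cu : ContinuousOn u (Set.Ioc 0 R) :=
      fun x hx => (gu.d0 x hx.1.le).continuousWithinAt.mono hsub
    have cu1 : ContinuousOn u1 (Set.Ioc 0 R) :=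
      fun x hx => (gu.d1 x hx.1.le).continuousWithinAt.mono hsub
    have cv : ContinuousOn v (Set.Ioc 0 R) :=
      fun x hx => (gv.d0 x hx.1.le).continuousWithinAt.mono hsub
    have cv1 : ContinuousOn v1 (Set.Ioc 0 R) :=
      fun x hx => (gv.d1 x hx.1.le).continuousWithinAt.mono hsub
    have cv2 : ContinuousOn v2 (Set.Ioc 0 R) :=
      fun x hx => (gv.d2 x hx.1.le).continuousWithinAt.mono hsub
    have cv3 : ContinuousOn v3 (Set.Ioc 0 R) := gv.c3.mono hsub
    have hc : ContinuousOn (EE u u1 v v1 v2 v3 (v1 0)) (Set.Ioc 0 R) := by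
      unfold EE TD TT
      fun_prop (disch := (intro x hx; have := hx.1.ne'; positivity))
    refine ⟨hc.aestronglyMeasurable measurableSet_Ioc,
      .restrict_of_bounded (C := M * (7 * K) + 6 * M * K) (by simp) ?_⟩
    filter_upwards [ae_restrict_mem measurableSet_Ioc] with r hr
    have hr0 := hr.1
    obtain ⟨a1, a0, -, -, -⟩ := hu r hr.1 hr.2
    obtain ⟨-, -, t, td, -⟩ := hv r hr.1 hr.2
    rw [Real.norm_eq_abs]
    unfold EE
    refine (abs_add_le _ _).trans (add_le_add ?_ ?_)
    · rw [abs_mul]; gcongr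
    · rw [abs_div, abs_mul, abs_mul, abs_of_pos (by positivity : (0:ℝ) < r ^ 2), abs_two,
        div_le_iff₀ (by positivity)]
      calc 2 * |u r| * |TT v v2 (v1 0) r| ≤ 2 * (M * r) * (3 * K * r) := by gcongr
        _ = _ := by ring
  · refine IntegrableOn.congr_fun integrableOn_zero (fun x hx => ?_) measurableSet_Ioi
    simp [EE, gu.z x hx, gu.z1 x hx]

lemma tendsto_aux (f : ℝ → ℝ) (C R : ℝ) (hR : 0 < R) (h : ∀ r, 0 < r → r ≤ R → |f r| ≤ C * r) :
    Filter.Tendsto f (nhdsWithin 0 (Set.Ioi 0)) (nhds 0) := by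
  refine squeeze_zero_norm' (a := fun r => C * r) ?_ ?_
  · filter_upwards [Ioc_mem_nhdsGT hR] with r hr using h r hr.1 hr.2
  · have : Filter.Tendsto (fun r : ℝ => C * r) (nhds 0) (nhds (C * 0)) :=
      (continuous_const.mul continuous_id).tendsto 0
    rw [mul_zero] at this
    exact this.mono_left nhdsWithin_le_nhds

lemma main_eq {u u1 u2 u3 v v1 v2 v3 : ℝ → ℝ} {R : ℝ} (hR : 0 < R) (κ : ℝ)
    (gu : Good u u1 u2 u3 R) (gv : Good v v1 v2 v3 R)
    (hu : 3 * u2 0 = 4 * κ * u1 0) (hv : 3 * v2 0 = 4 * κ * v1 0) :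
    ∫ r in Set.Ioi 0, EE u u1 v v1 v2 v3 (v1 0) r = ∫ r in Set.Ioi 0, EE v v1 u u1 u2 u3 (u1 0) r := by
  have iu := integrable_EE hR gu gv
  have iv := integrable_EE hR gv gu
  rw [← sub_eq_zero, ← integral_sub iu iv]
  obtain ⟨M, hM, bu⟩ := gu.bounds
  obtain ⟨K, hK, bv⟩ := gv.bounds
  let F : ℝ → ℝ := fun r => u1 r * TT v v2 (v1 0) r - v1 r * TT u u2 (u1 0) r
    + 2 * u1 0 * (GG v v1 (v1 0) r + 3 / 2 * v2 0) - 2 * v1 0 * (GG u u1 (u1 0) r + 3 / 2 * u2 0)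
  have hbc : u1 0 * v2 0 = v1 0 * u2 0 := by
    linear_combination u1 0 * hv / 3 - v1 0 * hu / 3
  have hd : ∀ r ∈ Set.Ioi (0:ℝ), HasDerivAt F
      (EE u u1 v v1 v2 v3 (v1 0) r - EE v v1 u u1 u2 u3 (u1 0) r) r := by
    intro r hr
    have hr' : 0 < r := hr
    have hr0 : r ≠ 0 := hr'.ne'
    have hm := Ici_mem_nhds hr'
    have du1 := (gu.d1 r hr'.le).hasDerivAt hm
    have dv1 := (gv.d1 r hr'.le).hasDerivAt hm
    have := (((du1.mul (hasDeriv_TT gv (v1 0) r hr)).sub (dv1.mul (hasDeriv_TT gu (u1 0) r hr))).add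
      (((hasDeriv_GG gv (v1 0) r hr).add_const (3 / 2 * v2 0)).const_mul (2 * u1 0))).sub
      (((hasDeriv_GG gu (u1 0) r hr).add_const (3 / 2 * u2 0)).const_mul (2 * v1 0))
    refine this.congr_deriv ?_
    unfold EE TT
    field_simp
    ring
  have h0 : Filter.Tendsto F (nhdsWithin 0 (Set.Ioi 0)) (nhds 0) := by
    refine tendsto_aux F (M * (3 * K) + K * (3 * M) + 2 * |u1 0| * (2 * K) + 2 * |v1 0| * (2 * M))
      R hR ?_
    intro r hr hrR
    obtain ⟨a1, -, aT, -, ag⟩ := bu r hr hrR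
    obtain ⟨b1, -, bt, -, bg⟩ := bv r hr hrR
    have e1 : |u1 r * TT v v2 (v1 0) r| ≤ M * (3 * K * r) := by rw [abs_mul]; gcongr
    have e2 : |v1 r * TT u u2 (u1 0) r| ≤ K * (3 * M * r) := by rw [abs_mul]; gcongr
    have e3 : |2 * u1 0 * (GG v v1 (v1 0) r + 3 / 2 * v2 0)| ≤ 2 * |u1 0| * (2 * K * r) := by
      rw [abs_mul, abs_mul, abs_two]; gcongr
    have e4 : |2 * v1 0 * (GG u u1 (u1 0) r + 3 / 2 * u2 0)| ≤ 2 * |v1 0| * (2 * M * r) := by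
      rw [abs_mul, abs_mul, abs_two]; gcongr
    rw [abs_le] at *
    constructor <;> simp only [F] <;> linarith [e1.1, e1.2, e2.1, e2.2, e3.1, e3.2, e4.1, e4.2]
  have hinf : Filter.Tendsto F Filter.atTop (nhds 0) := by
    refine Filter.Tendsto.congr' (f₁ := fun _ => (0:ℝ)) ?_ tendsto_const_nhds
    filter_upwards [Filter.eventually_gt_atTop R] with r hr
    simp only [F, GG, TT, gu.z r hr, gu.z1 r hr, gv.z r hr, gv.z1 r hr]
    linear_combination (-3) * hbc
  have hF0 : ∀ r, r ≠ 0 → Function.update F 0 0 r = F r := fun r hr => by simp [hr]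
  have := integral_Ioi_of_hasDerivAt_of_tendsto (a := 0) (m := 0) (f := Function.update F 0 0)
    ?_ (fun r hr => (hd r hr).congr_of_eventuallyEq ?_) (iu.sub iv) (hinf.congr' ?_)
  · simpa using this
  · rw [continuousWithinAt_update_same]
    simpa using h0
  · filter_upwards [Ioi_mem_nhds hr] with y hy using hF0 y (ne_of_gt hy)
  · filter_upwards [Filter.eventually_gt_atTop 0] with y hy using (hF0 y (ne_of_gt hy)).symm

lemma Dr_Tkappa {v : ℝ → ℝ} {R : ℝ} (g : Good v (Dr v) (Dr (Dr v)) (Dr (Dr (Dr v))) R)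
    (r : ℝ) (hr : 0 < r) : Dr (Tkappa v) r = TD v (Dr v) (Dr (Dr (Dr v))) (Dr v 0) r := by
  have : Tkappa v = TT v (Dr (Dr v)) (Dr v 0) := rfl
  rw [this]
  conv_lhs => unfold Dr
  rw [derivWithin_of_mem_nhds (Ici_mem_nhds hr)]
  exact (hasDeriv_TT g _ r hr).deriv

/-- Fix `κ ∈ ℝ`. For real-valued `u, v` of class `C⁴` on `[0, ∞)`,
compactly supported, with `u(0) = v(0) = 0` and boundary conditions
`3u''(0) = 4κ u'(0)`, `3v''(0) = 4κ v'(0)`, the integrals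
`⟨u, T_κ v⟩ = ∫₀^∞ (u'(T_κ v)' + 2u(T_κ v)/r²) dr` and `⟨T_κ u, v⟩` converge and
`⟨u, T_κ v⟩ = ⟨T_κ u, v⟩`. -/
theorem stmt6 (κ : ℝ) (u v : ℝ → ℝ)
    (hu : ContDiffOn ℝ 4 u (Set.Ici 0)) (hv : ContDiffOn ℝ 4 v (Set.Ici 0))
    (hus : HasCompactSupport u) (hvs : HasCompactSupport v)
    (hu0 : u 0 = 0) (hv0 : v 0 = 0)
    (hubc : 3 * Dr (Dr u) 0 = 4 * κ * Dr u 0)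
    (hvbc : 3 * Dr (Dr v) 0 = 4 * κ * Dr v 0) :
    IntegrableOn (fun r => Dr u r * Dr (Tkappa v) r + 2 * u r * Tkappa v r / r ^ 2)
      (Set.Ioi 0) ∧
    IntegrableOn (fun r => Dr (Tkappa u) r * Dr v r + 2 * Tkappa u r * v r / r ^ 2)
      (Set.Ioi 0) ∧
    (∫ r in Set.Ioi (0 : ℝ), (Dr u r * Dr (Tkappa v) r + 2 * u r * Tkappa v r / r ^ 2))
      = ∫ r in Set.Ioi (0 : ℝ), (Dr (Tkappa u) r * Dr v r + 2 * Tkappa u r * v r / r ^ 2) := by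

  obtain ⟨R₁, hR₁, G₁⟩ := good_of u hu hus hu0
  obtain ⟨R₂, hR₂, G₂⟩ := good_of v hv hvs hv0
  have gu := G₁ (max R₁ R₂) (le_max_left _ _)
  have gv := G₂ (max R₁ R₂) (le_max_right _ _)
  have hR : 0 < max R₁ R₂ := lt_max_of_lt_left hR₁
  have c1 : Set.EqOn (EE u (Dr u) v (Dr v) (Dr (Dr v)) (Dr (Dr (Dr v))) (Dr v 0))
      (fun r => Dr u r * Dr (Tkappa v) r + 2 * u r * Tkappa v r / r ^ 2) (Set.Ioi 0) := by
    intro r hr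
    simp only [Dr_Tkappa gv r hr]
    rfl
  have c2 : Set.EqOn (EE v (Dr v) u (Dr u) (Dr (Dr u)) (Dr (Dr (Dr u))) (Dr u 0))
      (fun r => Dr (Tkappa u) r * Dr v r + 2 * Tkappa u r * v r / r ^ 2) (Set.Ioi 0) := by
    intro r hr
    have : Tkappa u r = TT u (Dr (Dr u)) (Dr u 0) r := rfl
    simp only [Dr_Tkappa gu r hr, this, EE]
    ring
  refine ⟨(integrable_EE hR gu gv).congr_fun c1 measurableSet_Ioi,
    (integrable_EE hR gv gu).congr_fun c2 measurableSet_Ioi, ?_⟩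
  rw [← setIntegral_congr_fun measurableSet_Ioi c1, ← setIntegral_congr_fun measurableSet_Ioi c2]
  exact main_eq hR κ gu gv hubc hvbc
end

section
/- Let ρ > 0 and set σ = e^{∓3πi/4}·ρ (either choice of sign). Define c(r) = σ e^{σ r} - e^{σ r}/r + 1/r for r > 0. Then c satisfies (T c)(r) = ∓iρ²·(σ e^{σ r} - e^{σ r}/r) for all r > 0, hence (T c)(r) ± iρ² c(r) = ± iρ²/r, and consequently T applied to the function (T c ± iρ² c) vanishes identically on (0, ∞): c is a solution of the fourth-order equation T(T ± iρ²)c = 0. -/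
theorem aux_exp (σ : ℂ) (r : ℝ) :
    HasDerivAt (fun t : ℝ => Complex.exp (σ * t)) (σ * Complex.exp (σ * r)) r := by
  have h1 : HasDerivAt (fun z : ℂ => Complex.exp (σ * z)) (Complex.exp (σ * r) * (σ * 1)) (r : ℂ) :=
    ((hasDerivAt_id (r : ℂ)).const_mul σ).cexp
  have h2 := h1.comp_ofReal
  convert h2 using 1
  ring

theorem aux_id (r : ℝ) : HasDerivAt (fun t : ℝ => (t : ℂ)) 1 r :=
  (hasDerivAt_id (r : ℂ)).comp_ofReal

/-- Second derivative of `a e^{σr} + (b e^{σr} + k)/r` on the positive half-line. -/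
theorem aux_second (σ a b k : ℂ) (f : ℝ → ℂ)
    (hf : ∀ r : ℝ, 0 < r →
      f r = a * Complex.exp (σ * r) + (b * Complex.exp (σ * r) + k) / r)
    (r : ℝ) (hr : 0 < r) :
    deriv (deriv f) r = a * σ ^ 2 * Complex.exp (σ * r) + b * σ ^ 2 * Complex.exp (σ * r) / r
      - 2 * b * σ * Complex.exp (σ * r) / (r : ℂ) ^ 2
      + 2 * (b * Complex.exp (σ * r) + k) / (r : ℂ) ^ 3 := by
  have h1 : ∀ t : ℝ, 0 < t → deriv f t = a * (σ * Complex.exp (σ * t)) +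
      ((b * (σ * Complex.exp (σ * t))) * t - (b * Complex.exp (σ * t) + k) * 1) / (t : ℂ) ^ 2 := by
    intro t ht
    have ht' : (t : ℂ) ≠ 0 := by exact_mod_cast ht.ne'
    have e : f =ᶠ[nhds t]
        fun r : ℝ => a * Complex.exp (σ * r) + (b * Complex.exp (σ * r) + k) / r := by
      filter_upwards [Ioi_mem_nhds ht] with x hx using hf x hx
    rw [e.deriv_eq]
    exact (((aux_exp σ t).const_mul a).add
      ((((aux_exp σ t).const_mul b).add_const k).div (aux_id t) ht')).deriv
  have hr' : (r : ℂ) ≠ 0 := by exact_mod_cast hr.ne'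
  have e : deriv f =ᶠ[nhds r] fun t : ℝ => a * (σ * Complex.exp (σ * t)) +
      ((b * (σ * Complex.exp (σ * t))) * t - (b * Complex.exp (σ * t) + k) * 1) / (t : ℂ) ^ 2 := by
    filter_upwards [Ioi_mem_nhds hr] with x hx using h1 x hx
  rw [e.deriv_eq]
  have h2 := ((((aux_exp σ r).const_mul σ).const_mul a).add
      ((((((aux_exp σ r).const_mul σ).const_mul b).mul (aux_id r)).sub
        ((((aux_exp σ r).const_mul b).add_const k).mul_const 1)).div
        ((aux_id r).pow 2) (pow_ne_zero 2 hr'))).deriv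
  refine Eq.trans h2 ?_
  simp only [Pi.mul_apply, Pi.sub_apply, Pi.pow_apply]
  field_simp
  push_cast
  ring

theorem aux_sq (ρ ε : ℝ) (hε : ε = 1 ∨ ε = -1) :
    (Complex.exp (-(ε : ℂ) * (3 * Real.pi / 4) * Complex.I) * ρ) ^ 2
      = (ε : ℂ) * Complex.I * (ρ : ℂ) ^ 2 := by
  rw [mul_pow, ← Complex.exp_nat_mul]
  congr 1
  rcases hε with rfl | rfl
  · have : ((2 : ℕ) : ℂ) * (-((1 : ℝ) : ℂ) * (3 * Real.pi / 4) * Complex.I)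
        = Real.pi / 2 * Complex.I - 2 * Real.pi * Complex.I := by
      push_cast; ring
    rw [this, Complex.exp_sub, Complex.exp_two_pi_mul_I, Complex.exp_pi_div_two_mul_I]
    simp
  · have : ((2 : ℕ) : ℂ) * (-((-1 : ℝ) : ℂ) * (3 * Real.pi / 4) * Complex.I)
        = -Real.pi / 2 * Complex.I + 2 * Real.pi * Complex.I := by
      push_cast; ring
    rw [this, Complex.exp_add, Complex.exp_two_pi_mul_I, Complex.exp_neg_pi_div_two_mul_I]
    simp

/-- Let `ρ > 0` and `σ = e^{∓3πi/4} ρ` (sign choice encoded by `ε = ±1`,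
`σ = e^{-ε·3πi/4} ρ`). For `c(r) = σ e^{σr} - e^{σr}/r + 1/r` one has
`(T c)(r) = ∓iρ² (σ e^{σr} - e^{σr}/r)` for all `r > 0`, hence
`(T c)(r) ± iρ² c(r) = ±iρ²/r`, and consequently `T (T c ± iρ² c) = 0` on `(0, ∞)`,
i.e. `c` solves the fourth-order equation `T(T ± iρ²) c = 0`. -/
theorem stmt7 (ρ ε : ℝ) (hρ : 0 < ρ) (hε : ε = 1 ∨ ε = -1)
    (σ : ℂ) (hσ : σ = Complex.exp (-(ε : ℂ) * (3 * Real.pi / 4) * Complex.I) * ρ)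
    (c : ℝ → ℂ)
    (hc : ∀ r : ℝ, c r = σ * Complex.exp (σ * r) - Complex.exp (σ * r) / r + 1 / r) :
    (∀ r ∈ Set.Ioi (0 : ℝ),
      -deriv (deriv c) r + 2 * c r / (r : ℂ) ^ 2
        = -(ε : ℂ) * Complex.I * (ρ : ℂ) ^ 2
            * (σ * Complex.exp (σ * r) - Complex.exp (σ * r) / r)) ∧
    (∀ r ∈ Set.Ioi (0 : ℝ),
      (-deriv (deriv c) r + 2 * c r / (r : ℂ) ^ 2)
          + (ε : ℂ) * Complex.I * (ρ : ℂ) ^ 2 * c r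
        = (ε : ℂ) * Complex.I * (ρ : ℂ) ^ 2 / r) ∧
    (∀ r ∈ Set.Ioi (0 : ℝ),
      -deriv (deriv (fun t : ℝ =>
          (-deriv (deriv c) t + 2 * c t / (t : ℂ) ^ 2)
            + (ε : ℂ) * Complex.I * (ρ : ℂ) ^ 2 * c t)) r
        + 2 * ((-deriv (deriv c) r + 2 * c r / (r : ℂ) ^ 2)
            + (ε : ℂ) * Complex.I * (ρ : ℂ) ^ 2 * c r) / (r : ℂ) ^ 2
        = 0) := by
  have hs : σ ^ 2 = (ε : ℂ) * Complex.I * (ρ : ℂ) ^ 2 := by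
    rw [hσ]; exact aux_sq ρ ε hε
  have h1 : ∀ r ∈ Set.Ioi (0 : ℝ),
      -deriv (deriv c) r + 2 * c r / (r : ℂ) ^ 2
        = -(ε : ℂ) * Complex.I * (ρ : ℂ) ^ 2
            * (σ * Complex.exp (σ * r) - Complex.exp (σ * r) / r) := by
    intro r hr
    have hr' : (r : ℂ) ≠ 0 := by exact_mod_cast (ne_of_gt hr)
    have e : -(ε : ℂ) * Complex.I * (ρ : ℂ) ^ 2 = -σ ^ 2 := by rw [hs]; ring
    rw [e, aux_second σ σ (-1) 1 c (fun t _ => by rw [hc]; ring) r hr, hc]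
    field_simp
    ring
  have h2 : ∀ r ∈ Set.Ioi (0 : ℝ),
      (-deriv (deriv c) r + 2 * c r / (r : ℂ) ^ 2)
          + (ε : ℂ) * Complex.I * (ρ : ℂ) ^ 2 * c r
        = (ε : ℂ) * Complex.I * (ρ : ℂ) ^ 2 / r := by
    intro r hr
    rw [h1 r hr, hc]
    ring
  refine ⟨h1, h2, ?_⟩
  intro r hr
  have hr' : (r : ℂ) ≠ 0 := by exact_mod_cast (ne_of_gt hr)
  rw [h2 r hr, aux_second 0 0 0 ((ε : ℂ) * Complex.I * (ρ : ℂ) ^ 2) _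
    (fun t ht => by rw [h2 t ht]; ring) r hr]
  field_simp
  ring
end

section
/- Let κ ∈ ℝ, let z be a complex number with z ≠ -iκ, and set β = (z - iκ)/(z + iκ). Define f(r) = (-iz e^{-izr} - e^{-izr}/r) + β(iz e^{izr} - e^{izr}/r) + (1+β)/r for r > 0. Then f extends continuously to r = 0 with f(0) = 0, the limits f'(0) = lim_{r→0} f'(r) and f''(0) = lim_{r→0} f''(r) exist and equal f'(0) = -z²(1+β)/2 and f''(0) = (2iz³/3)(1-β), and f satisfies the boundary condition 3f''(0) = 4κ f'(0). -/
open Filter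

/-- The regularised building block `D e^{σ w} + 1/w` is entire, with known 2-jet at `0`. -/
theorem stmt11_aux (σ : ℂ) : ∃ G G1 G2 : ℂ → ℂ,
    (∀ w, HasDerivAt G (G1 w) w) ∧ (∀ w, HasDerivAt G1 (G2 w) w) ∧ Continuous G2 ∧
    (∀ w, w ≠ 0 → G w = σ * Complex.exp (σ * w) - Complex.exp (σ * w) / w + 1 / w) ∧
    G 0 = 0 ∧ G1 0 = σ ^ 2 / 2 ∧ G2 0 = 2 * σ ^ 3 / 3 := by
  have hE : ∀ w : ℂ, HasDerivAt (fun w => Complex.exp (σ * w)) (σ * Complex.exp (σ * w)) w := by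
    intro w
    have h := ((hasDerivAt_id w).const_mul σ).cexp
    simpa [mul_comm] using h
  have hEd : Differentiable ℂ (fun w => Complex.exp (σ * w)) :=
    fun w => (hE w).differentiableAt
  obtain ⟨H, hH⟩ : ∃ H, H = dslope (fun w => Complex.exp (σ * w)) 0 := ⟨_, rfl⟩
  have hHd : Differentiable ℂ H := by
    rw [← differentiableOn_univ, hH]
    exact (Complex.differentiableOn_dslope Filter.univ_mem).2 hEd.differentiableOn
  have hH1d : Differentiable ℂ (deriv H) := by
    rw [← differentiableOn_univ]
    exact hHd.differentiableOn.deriv isOpen_univ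
  have hH2d : Differentiable ℂ (deriv (deriv H)) := by
    rw [← differentiableOn_univ]
    exact hH1d.differentiableOn.deriv isOpen_univ
  have e0 : ∀ w, w * H w = Complex.exp (σ * w) - 1 := by
    intro w
    have h := sub_smul_dslope (fun w => Complex.exp (σ * w)) 0 w
    rw [← hH] at h
    simpa using h
  have e1 : ∀ w, H w + w * deriv H w = σ * Complex.exp (σ * w) := by
    intro w
    have h1 := (hasDerivAt_id w).mul (hHd w).hasDerivAt
    have h2 := (hE w).sub_const 1
    have h3 : (id * H) = fun w => Complex.exp (σ * w) - 1 := funext e0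
    rw [h3] at h1
    simpa using h1.unique h2
  have e2 : ∀ w, 2 * deriv H w + w * deriv (deriv H) w = σ ^ 2 * Complex.exp (σ * w) := by
    intro w
    have h1 := (hHd w).hasDerivAt.add ((hasDerivAt_id w).mul (hH1d w).hasDerivAt)
    have h2 := (hE w).const_mul σ
    have h3 : (H + id * deriv H) = fun w => σ * Complex.exp (σ * w) := funext e1
    rw [h3] at h1
    have h := h1.unique h2
    simp only [id] at h
    linear_combination h
  have e3 : ∀ w, 3 * deriv (deriv H) w + w * deriv (deriv (deriv H)) w
      = σ ^ 3 * Complex.exp (σ * w) := by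
    intro w
    have h1 := ((hH1d w).hasDerivAt.const_mul 2).add
      ((hasDerivAt_id w).mul (hH2d w).hasDerivAt)
    have h2 := (hE w).const_mul (σ ^ 2)
    have h3 : ((fun w => 2 * deriv H w) + id * deriv (deriv H))
        = fun w => σ ^ 2 * Complex.exp (σ * w) := funext e2
    rw [h3] at h1
    have h := h1.unique h2
    simp only [id] at h
    linear_combination h
  refine ⟨fun w => σ * Complex.exp (σ * w) - H w,
    fun w => σ * (σ * Complex.exp (σ * w)) - deriv H w,
    fun w => σ * (σ * (σ * Complex.exp (σ * w))) - deriv (deriv H) w, ?_, ?_, ?_, ?_, ?_, ?_, ?_⟩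
  · exact fun w => ((hE w).const_mul σ).sub (hHd w).hasDerivAt
  · exact fun w => (((hE w).const_mul σ).const_mul σ).sub (hH1d w).hasDerivAt
  · have := hH2d.continuous
    fun_prop
  · intro w hw
    have h := e0 w
    field_simp
    linear_combination -h
  · have h := e1 0
    simp at h
    simp [h]
  · have h := e2 0
    simp at h
    simp
    linear_combination -h / 2
  · have h := e3 0
    simp at h
    simp
    linear_combination -h / 3

/-- Let `κ ∈ ℝ`, `z ∈ ℂ` with `z ≠ -iκ`, `β = (z - iκ)/(z + iκ)`, and
`f(r) = D e^{-izr} + β D e^{izr} + (1+β)/r`. Then `f` extends continuously to `0` with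
`f(0) = 0`, the limits `f'(0)` and `f''(0)` exist and equal `-z²(1+β)/2` and
`(2iz³/3)(1-β)`, and `f` satisfies the boundary condition `3 f''(0) = 4κ f'(0)`. -/
theorem stmt11 (κ : ℝ) (z : ℂ) (hz : z ≠ -(Complex.I * κ))
    (β : ℂ) (hβ : β = (z - Complex.I * κ) / (z + Complex.I * κ))
    (f : ℝ → ℂ)
    (hf : ∀ r : ℝ, f r =
        (-(Complex.I * z) * Complex.exp (-(Complex.I * z) * r)
            - Complex.exp (-(Complex.I * z) * r) / r)
          + β * (Complex.I * z * Complex.exp (Complex.I * z * r)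
            - Complex.exp (Complex.I * z * r) / r)
          + (1 + β) / r) :
    Tendsto f (nhdsWithin 0 (Set.Ioi 0)) (nhds 0) ∧
    Tendsto (deriv f) (nhdsWithin 0 (Set.Ioi 0)) (nhds (-z ^ 2 * (1 + β) / 2)) ∧
    Tendsto (deriv (deriv f)) (nhdsWithin 0 (Set.Ioi 0))
      (nhds ((2 * Complex.I * z ^ 3 / 3) * (1 - β))) ∧
    3 * ((2 * Complex.I * z ^ 3 / 3) * (1 - β)) = 4 * (κ : ℂ) * (-z ^ 2 * (1 + β) / 2) := by
  obtain ⟨A, A1, A2, hA, hA1, cA, eA, a0, a1, a2⟩ := stmt11_aux (-(Complex.I * z))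
  obtain ⟨B, B1, B2, hB, hB1, cB, eB, b0, b1, b2⟩ := stmt11_aux (Complex.I * z)
  have hI2 : Complex.I ^ 2 = -1 := Complex.I_sq
  have hpos : ∀ᶠ r : ℝ in nhdsWithin 0 (Set.Ioi 0), 0 < r := self_mem_nhdsWithin
  have f0 : ∀ r : ℝ, 0 < r → f r = A r + β * B r := by
    intro r hr
    have hr' : (r : ℂ) ≠ 0 := by exact_mod_cast hr.ne'
    rw [hf, eA _ hr', eB _ hr']
    ring
  have f1 : ∀ r : ℝ, 0 < r → deriv f r = A1 r + β * B1 r := by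
    intro r hr
    have h : HasDerivAt (fun r : ℝ => A r + β * B r) (A1 r + β * B1 r) r :=
      (hA r).comp_ofReal.add ((hB r).comp_ofReal.const_mul β)
    refine (h.congr_of_eventuallyEq ?_).deriv
    filter_upwards [lt_mem_nhds hr] with x hx using f0 x hx
  have f2 : ∀ r : ℝ, 0 < r → deriv (deriv f) r = A2 r + β * B2 r := by
    intro r hr
    have h : HasDerivAt (fun r : ℝ => A1 r + β * B1 r) (A2 r + β * B2 r) r :=
      (hA1 r).comp_ofReal.add ((hB1 r).comp_ofReal.const_mul β)
    refine (h.congr_of_eventuallyEq ?_).deriv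
    filter_upwards [lt_mem_nhds hr] with x hx using f1 x hx
  have key : ∀ (g : ℝ → ℂ) (P Q : ℂ → ℂ) (c : ℂ), Continuous P → Continuous Q →
      (∀ r : ℝ, 0 < r → g r = P r + β * Q r) → P 0 + β * Q 0 = c →
      Tendsto g (nhdsWithin 0 (Set.Ioi 0)) (nhds c) := by
    intro g P Q c hP hQ hg hc
    have hcont : Continuous (fun r : ℝ => P r + β * Q r) := by fun_prop
    have h := (hcont.tendsto 0).mono_left (nhdsWithin_le_nhds (s := Set.Ioi 0))
    simp only [Complex.ofReal_zero, hc] at h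
    refine h.congr' ?_
    filter_upwards [hpos] with r hr using (hg r hr).symm
  have cont : ∀ P P' : ℂ → ℂ, (∀ w, HasDerivAt P (P' w) w) → Continuous P :=
    fun P P' h => continuous_iff_continuousAt.2 fun w => (h w).continuousAt
  refine ⟨key f A B _ (cont _ _ hA) (cont _ _ hB) f0 (by simp [a0, b0]),
    key _ A1 B1 _ (cont _ _ hA1) (cont _ _ hB1) f1 ?_, key _ A2 B2 _ cA cB f2 ?_, ?_⟩
  · rw [a1, b1]
    linear_combination (z ^ 2 / 2 * (1 + β)) * hI2
  · rw [a2, b2]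
    linear_combination (-(2 * Complex.I * z ^ 3 / 3) * (1 - β)) * hI2
  · have hne : z + Complex.I * κ ≠ 0 := fun h => hz (eq_neg_of_add_eq_zero_left h)
    have hb : β * (z + Complex.I * κ) = z - Complex.I * κ := by
      rw [hβ]
      field_simp
    linear_combination (-2 * Complex.I * z ^ 2) * hb
      + (2 * κ * z ^ 2 * (1 + β)) * hI2
end

section
/- Let λ > 0 and κ ∈ ℝ, and let ζ ∈ ℂ satisfy e^{2iζ} = (λ - iκ)/(λ + iκ). Define p(r) = (1/(√(2π) λ²)) · ( e^{iζ}(iλ e^{iλ r} - e^{iλ r}/r) + e^{-iζ}(-iλ e^{-iλ r} - e^{-iλ r}/r) + (e^{iζ} + e^{-iζ})/r ) for r > 0. Then p is real-valued and extends continuously to 0 with p(0) = 0. The limit p'(0) = lim_{r→0} p'(r) exists and equals -(cos ζ)/√(2π). Moreover, p satisfies -p''(r) + 2p(r)/r² - (2/r)·p'(0) = λ² p(r) for all r > 0; that is, T_κ p = λ² p. -/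
open Filter

noncomputable def gg (σ : ℂ) (r : ℝ) : ℂ :=
  σ * Complex.exp (σ * r) - (Complex.exp (σ * r) - 1) / r

noncomputable def gg1 (σ : ℂ) (r : ℝ) : ℂ :=
  σ ^ 2 * Complex.exp (σ * r) + (Complex.exp (σ * r) - 1 - σ * r) / (r : ℂ) ^ 2
    - σ * ((Complex.exp (σ * r) - 1) / r)

lemma hasDerivAt_ee (σ : ℂ) (r : ℝ) :
    HasDerivAt (fun r : ℝ => Complex.exp (σ * r)) (σ * Complex.exp (σ * r)) r := by
  have h0 : HasDerivAt (fun r : ℝ => (r : ℂ)) 1 r := Complex.ofRealCLM.hasDerivAt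
  have h1 := (h0.const_mul σ).cexp
  convert h1 using 1
  ring

lemma hasDerivAt_gg (σ : ℂ) (r : ℝ) (hr : r ≠ 0) : HasDerivAt (gg σ) (gg1 σ r) r := by
  have hr' : (r : ℂ) ≠ 0 := by exact_mod_cast hr
  have h0 : HasDerivAt (fun r : ℝ => (r : ℂ)) 1 r := Complex.ofRealCLM.hasDerivAt
  have he := hasDerivAt_ee σ r
  have h := (he.const_mul σ).sub ((he.sub_const 1).div h0 hr')
  refine h.congr_deriv ?_
  unfold gg1
  field_simp
  ring

lemma hasDerivAt_gg1 (σ : ℂ) (r : ℝ) (hr : r ≠ 0) :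
    HasDerivAt (gg1 σ) (2 * gg σ r / (r : ℂ) ^ 2 + σ ^ 2 * gg σ r - σ ^ 2 / r) r := by
  have hr' : (r : ℂ) ≠ 0 := by exact_mod_cast hr
  have h0 : HasDerivAt (fun r : ℝ => (r : ℂ)) 1 r := Complex.ofRealCLM.hasDerivAt
  have he := hasDerivAt_ee σ r
  have h := ((he.const_mul (σ ^ 2)).add
    (((he.sub_const 1).sub (h0.const_mul σ)).div (h0.pow 2) (pow_ne_zero 2 hr'))).sub
    (((he.sub_const 1).div h0 hr').const_mul σ)
  refine h.congr_deriv ?_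
  unfold gg
  simp only [Pi.pow_apply, Pi.sub_apply]
  field_simp
  ring

lemma tendsto_sr (σ : ℂ) :
    Tendsto (fun r : ℝ => σ * (r : ℂ)) (nhdsWithin 0 (Set.Ioi 0)) (nhds 0) := by
  have : Continuous (fun r : ℝ => σ * (r : ℂ)) := by fun_prop
  have h := this.tendsto 0
  simp only [Complex.ofReal_zero, mul_zero] at h
  exact h.mono_left nhdsWithin_le_nhds

lemma tendsto_ee (σ : ℂ) :
    Tendsto (fun r : ℝ => Complex.exp (σ * (r : ℂ))) (nhdsWithin 0 (Set.Ioi 0)) (nhds 1) := by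
  have h := (Complex.continuous_exp.tendsto 0).comp (tendsto_sr σ)
  rw [Complex.exp_zero] at h
  exact h

lemma tendsto_q2 (σ : ℂ) (hσ : σ ≠ 0) :
    Tendsto (fun r : ℝ => (Complex.exp (σ * r) - 1 - σ * r) / (r : ℂ) ^ 2)
      (nhdsWithin 0 (Set.Ioi 0)) (nhds (σ ^ 2 / 2)) := by
  have h := (Complex.exp_sub_sum_range_succ_isLittleO_pow 2).tendsto_div_nhds_zero.comp
    (tendsto_sr σ)
  have h2 := (h.const_mul (σ ^ 2)).add_const (σ ^ 2 / 2)
  simp only [mul_zero, zero_add] at h2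
  refine h2.congr' ?_
  filter_upwards [self_mem_nhdsWithin] with r hr
  have hr' : (r : ℂ) ≠ 0 := by exact_mod_cast (ne_of_gt hr)
  simp [Finset.sum_range_succ]
  field_simp
  ring

lemma tendsto_q1 (σ : ℂ) (hσ : σ ≠ 0) :
    Tendsto (fun r : ℝ => (Complex.exp (σ * r) - 1) / (r : ℂ))
      (nhdsWithin 0 (Set.Ioi 0)) (nhds σ) := by
  have h := ((tendsto_q2 σ hσ).mul (tendsto_sr 1)).add_const σ
  simp only [mul_zero, zero_add] at h
  refine h.congr' ?_
  filter_upwards [self_mem_nhdsWithin] with r hr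
  have hr' : (r : ℂ) ≠ 0 := by exact_mod_cast (ne_of_gt hr)
  field_simp
  ring

lemma tendsto_gg (σ : ℂ) (hσ : σ ≠ 0) :
    Tendsto (gg σ) (nhdsWithin 0 (Set.Ioi 0)) (nhds 0) := by
  have h := ((tendsto_ee σ).const_mul σ).sub (tendsto_q1 σ hσ)
  have e : σ * 1 - σ = 0 := by ring
  rw [e] at h
  exact h

lemma tendsto_gg1 (σ : ℂ) (hσ : σ ≠ 0) :
    Tendsto (gg1 σ) (nhdsWithin 0 (Set.Ioi 0)) (nhds (σ ^ 2 / 2)) := by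
  have h := (((tendsto_ee σ).const_mul (σ ^ 2)).add (tendsto_q2 σ hσ)).sub
    ((tendsto_q1 σ hσ).const_mul σ)
  have e : σ ^ 2 * 1 + σ ^ 2 / 2 - σ * σ = σ ^ 2 / 2 := by ring
  rw [e] at h
  exact h

lemma zeta_im (lam κ : ℝ) (hlam : 0 < lam) (ζ : ℂ)
    (hζ : Complex.exp (2 * Complex.I * ζ)
        = ((lam : ℂ) - Complex.I * κ) / ((lam : ℂ) + Complex.I * κ)) : ζ.im = 0 := by
  have hne : (lam : ℂ) + Complex.I * κ ≠ 0 := by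
    intro h
    have := congrArg Complex.re h
    simp at this
    exact hlam.ne' this
  have hc : (lam : ℂ) - Complex.I * κ = (starRingEnd ℂ) ((lam : ℂ) + Complex.I * κ) := by
    simp [sub_eq_add_neg]
  have h := congrArg norm hζ
  rw [hc, norm_div, Complex.norm_conj, div_self (norm_ne_zero_iff.mpr hne), Complex.norm_exp,
    Real.exp_eq_one_iff] at h
  simp at h
  exact h

/-- Let `λ > 0`, `κ ∈ ℝ`, and `ζ ∈ ℂ` with `e^{2iζ} = (λ - iκ)/(λ + iκ)`.
Define `p(r) = (1/(√(2π) λ²)) (e^{iζ} D e^{iλr} + e^{-iζ} D e^{-iλr} + (e^{iζ}+e^{-iζ})/r)`.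
Then `p` is real-valued, extends continuously to `0` with `p(0) = 0`, the limit
`p'(0)` exists and equals `-(cos ζ)/√(2π)`, and `p` satisfies
`-p'' + 2p/r² - (2/r) p'(0) = λ² p` on `(0, ∞)`, i.e. `T_κ p = λ² p`. -/
theorem stmt14 (lam κ : ℝ) (hlam : 0 < lam) (ζ : ℂ)
    (hζ : Complex.exp (2 * Complex.I * ζ)
        = ((lam : ℂ) - Complex.I * κ) / ((lam : ℂ) + Complex.I * κ))
    (p : ℝ → ℂ)
    (hp : ∀ r : ℝ, p r =
        (1 / ((Real.sqrt (2 * Real.pi) : ℂ) * (lam : ℂ) ^ 2)) *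
          (Complex.exp (Complex.I * ζ)
              * (Complex.I * lam * Complex.exp (Complex.I * lam * r)
                  - Complex.exp (Complex.I * lam * r) / r)
            + Complex.exp (-(Complex.I * ζ))
              * (-(Complex.I * lam) * Complex.exp (-(Complex.I * lam) * r)
                  - Complex.exp (-(Complex.I * lam) * r) / r)
            + (Complex.exp (Complex.I * ζ) + Complex.exp (-(Complex.I * ζ))) / r)) :
    (∀ r ∈ Set.Ioi (0 : ℝ), (p r).im = 0) ∧
    Tendsto p (nhdsWithin 0 (Set.Ioi 0)) (nhds 0) ∧
    Tendsto (deriv p) (nhdsWithin 0 (Set.Ioi 0))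
      (nhds (-(Complex.cos ζ) / (Real.sqrt (2 * Real.pi) : ℂ))) ∧
    ∀ r ∈ Set.Ioi (0 : ℝ),
      -deriv (deriv p) r + 2 * p r / (r : ℂ) ^ 2
          - (2 / (r : ℂ)) * (-(Complex.cos ζ) / (Real.sqrt (2 * Real.pi) : ℂ))
        = (lam : ℂ) ^ 2 * p r := by
  have hσ : Complex.I * (lam : ℂ) ≠ 0 :=
    mul_ne_zero Complex.I_ne_zero (by exact_mod_cast hlam.ne')
  have hσ' : -(Complex.I * (lam : ℂ)) ≠ 0 := neg_ne_zero.mpr hσ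
  have hl : (lam : ℂ) ≠ 0 := by exact_mod_cast hlam.ne'
  have hs : ((Real.sqrt (2 * Real.pi) : ℝ) : ℂ) ≠ 0 := by
    have : Real.sqrt (2 * Real.pi) ≠ 0 := by positivity
    exact_mod_cast this
  have hcos : Complex.cos ζ =
      (Complex.exp (Complex.I * ζ) + Complex.exp (-(Complex.I * ζ))) / 2 := by
    rw [Complex.cos]
    congr 3 <;> ring_nf
  have hs2 : (Complex.I * (lam : ℂ)) ^ 2 = -(lam : ℂ) ^ 2 := by
    rw [mul_pow, Complex.I_sq]; ring
  have him := zeta_im lam κ hlam ζ hζ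
  have hzc : (starRingEnd ℂ) ζ = ζ := Complex.conj_eq_iff_im.mpr him
  have hreal : ∀ r ∈ Set.Ioi (0 : ℝ), (p r).im = 0 := by
    intro r _
    rw [← Complex.conj_eq_iff_im, hp r]
    simp only [map_mul, map_add, map_sub, map_div₀, map_one, map_neg, map_pow, ← Complex.exp_conj,
      Complex.conj_I, Complex.conj_ofReal, hzc, neg_mul, neg_neg]
    ring
  rw [hcos]
  have hpg : p = fun r => (1 / ((Real.sqrt (2 * Real.pi) : ℂ) * (lam : ℂ) ^ 2)) *
      (Complex.exp (Complex.I * ζ) * gg (Complex.I * lam) r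
        + Complex.exp (-(Complex.I * ζ)) * gg (-(Complex.I * lam)) r) := by
    funext r
    rw [hp r]
    unfold gg
    ring
  generalize Complex.exp (Complex.I * ζ) = a at *
  generalize Complex.exp (-(Complex.I * ζ)) = b at *
  generalize ((Real.sqrt (2 * Real.pi) : ℝ) : ℂ) = S at *
  generalize Complex.I * (lam : ℂ) = σ at *
  have hd1 : ∀ r : ℝ, r ≠ 0 → HasDerivAt p
      ((1 / (S * (lam : ℂ) ^ 2)) * (a * gg1 σ r + b * gg1 (-σ) r)) r := by
    intro r hr
    rw [hpg]
    exact (((hasDerivAt_gg σ r hr).const_mul a).add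
      ((hasDerivAt_gg (-σ) r hr).const_mul b)).const_mul _
  refine ⟨hreal, ?_, ?_, ?_⟩
  · rw [hpg]
    have h := (((tendsto_gg σ hσ).const_mul a).add ((tendsto_gg (-σ) hσ').const_mul b)).const_mul
      (1 / (S * (lam : ℂ) ^ 2))
    simpa using h
  · have h := (((tendsto_gg1 σ hσ).const_mul a).add
      ((tendsto_gg1 (-σ) hσ').const_mul b)).const_mul (1 / (S * (lam : ℂ) ^ 2))
    have h' := h.congr' (f₂ := deriv p) (by
      filter_upwards [self_mem_nhdsWithin] with r hr
      exact (hd1 r (ne_of_gt hr)).deriv.symm)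
    convert h' using 2
    rw [neg_sq, hs2]
    field_simp
    ring
  · intro r hr
    have hr0 : r ≠ 0 := ne_of_gt hr
    have hr' : (r : ℂ) ≠ 0 := by exact_mod_cast hr0
    have hev : deriv p =ᶠ[nhds r] fun r =>
        (1 / (S * (lam : ℂ) ^ 2)) * (a * gg1 σ r + b * gg1 (-σ) r) := by
      filter_upwards [isOpen_ne.mem_nhds hr0] with x hx
      exact (hd1 x hx).deriv
    have hd2 := (((hasDerivAt_gg1 σ r hr0).const_mul a).add
      ((hasDerivAt_gg1 (-σ) r hr0).const_mul b)).const_mul (1 / (S * (lam : ℂ) ^ 2))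
    rw [hev.deriv_eq]
    erw [hd2.deriv]
    rw [hpg, neg_sq, hs2]
    beta_reduce
    generalize gg σ r = x
    generalize gg (-σ) r = y
    field_simp
    ring
end

section
/- Let κ > 0, set σ = 2^{-1/6} e^{3iπ/4} κ, and define q̂(r) = i·√(2/(3κ³)) · ( (σ e^{σ r} - e^{σ r}/r) - (σ̄ e^{σ̄ r} - e^{σ̄ r}/r) ) for r > 0, where σ̄ is the complex conjugate of σ. Then q̂ is real-valued, and applying the operation T u = -u'' + 2u/r² twice gives T(T q̂)(r) = -2^{-2/3} κ⁴ · q̂(r) for all r > 0. Equivalently, q̂ is an eigenfunction of the squared operation T² with eigenvalue σ⁴ = -2^{-2/3}κ⁴, so that q̂ is the discrete-spectrum eigenfunction of the inverse-square operator T⁻²_κ with eigenvalue -2^{2/3} κ^{-4}. -/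
/-- The differential operation `T u = -u'' + 2u/r²` on complex-valued functions of `r > 0`. -/
noncomputable def Tc (u : ℝ → ℂ) : ℝ → ℂ :=
  fun r => -deriv (deriv u) r + 2 * u r / (r : ℂ) ^ 2

noncomputable def Gaux (a b σ τ : ℂ) (r : ℝ) : ℂ :=
  a * (σ * Complex.exp (σ * r) - Complex.exp (σ * r) / r)
    + b * (τ * Complex.exp (τ * r) - Complex.exp (τ * r) / r)

lemma hexp_aux (σ : ℂ) (r : ℝ) :
    HasDerivAt (fun x : ℝ => Complex.exp (σ * x)) (Complex.exp (σ * r) * σ) r := by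
  have h : HasDerivAt (fun x : ℝ => σ * (x : ℂ)) (σ * 1) r :=
    (Complex.ofRealCLM.hasDerivAt (x := r)).const_mul σ
  simpa using h.cexp

lemma hg1_aux (σ : ℂ) (r : ℝ) (hr : 0 < r) :
    HasDerivAt (fun x : ℝ => σ * Complex.exp (σ * x) - Complex.exp (σ * x) / x)
      (σ ^ 2 * Complex.exp (σ * r) - σ * Complex.exp (σ * r) / r
        + Complex.exp (σ * r) / r ^ 2) r := by
  have hr' : (r : ℂ) ≠ 0 := by exact_mod_cast hr.ne'
  have h1 : HasDerivAt (fun x : ℝ => (x : ℂ)) 1 r := Complex.ofRealCLM.hasDerivAt (x := r)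
  have h := ((hexp_aux σ r).const_mul σ).sub ((hexp_aux σ r).div h1 hr')
  refine h.congr_deriv ?_
  field_simp
  ring

lemma hg2_aux (σ : ℂ) (r : ℝ) (hr : 0 < r) :
    HasDerivAt (fun x : ℝ => σ ^ 2 * Complex.exp (σ * x) - σ * Complex.exp (σ * x) / x
        + Complex.exp (σ * x) / (x : ℂ) ^ 2)
      (σ ^ 2 * (σ * Complex.exp (σ * r) - Complex.exp (σ * r) / r)
        + 2 * (σ * Complex.exp (σ * r) - Complex.exp (σ * r) / r) / (r : ℂ) ^ 2) r := by
  have hr' : (r : ℂ) ≠ 0 := by exact_mod_cast hr.ne'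
  have h1 : HasDerivAt (fun x : ℝ => (x : ℂ)) 1 r := Complex.ofRealCLM.hasDerivAt (x := r)
  have h2 : HasDerivAt (fun x : ℝ => (x : ℂ) ^ 2) (2 * r) r := by simpa using h1.fun_pow 2
  have h := (((hexp_aux σ r).const_mul (σ ^ 2)).sub
    (((hexp_aux σ r).const_mul σ).div h1 hr')).add
    ((hexp_aux σ r).div h2 (pow_ne_zero 2 hr'))
  refine h.congr_deriv ?_
  field_simp
  ring

lemma Tc_aux (a b σ τ : ℂ) (u : ℝ → ℂ) (hu : ∀ r : ℝ, 0 < r → u r = Gaux a b σ τ r) :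
    ∀ r : ℝ, 0 < r → Tc u r = Gaux (-(a * σ ^ 2)) (-(b * τ ^ 2)) σ τ r := by
  have hd : ∀ r : ℝ, 0 < r → deriv u r =
      a * (σ ^ 2 * Complex.exp (σ * r) - σ * Complex.exp (σ * r) / r
        + Complex.exp (σ * r) / (r : ℂ) ^ 2)
      + b * (τ ^ 2 * Complex.exp (τ * r) - τ * Complex.exp (τ * r) / r
        + Complex.exp (τ * r) / (r : ℂ) ^ 2) := by
    intro r hr
    have h := ((hg1_aux σ r hr).const_mul a).add ((hg1_aux τ r hr).const_mul b)
    refine (h.congr_of_eventuallyEq ?_).deriv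
    filter_upwards [lt_mem_nhds hr] with x hx
    exact hu x hx
  intro r hr
  have h := ((hg2_aux σ r hr).const_mul a).add ((hg2_aux τ r hr).const_mul b)
  have hdd := (h.congr_of_eventuallyEq (f₁ := deriv u) (by
    filter_upwards [lt_mem_nhds hr] with x hx
    exact hd x hx)).deriv
  simp only [Tc]
  rw [hdd, hu r hr]
  simp only [Gaux]
  ring

/-- Let `κ > 0`, `σ = 2^{-1/6} e^{3iπ/4} κ`, and
`q̂(r) = i √(2/(3κ³)) (D e^{σr} - D e^{σ̄r})`. Then `q̂` is real-valued, and applying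
`T u = -u'' + 2u/r²` twice gives `T(T q̂) = -2^{-2/3} κ⁴ q̂` on `(0, ∞)`; moreover
`σ⁴ = -2^{-2/3} κ⁴` (so `q̂` is the discrete-spectrum eigenfunction of `T⁻²_κ` with
eigenvalue `-2^{2/3} κ⁻⁴`). -/
theorem stmt18 (κ : ℝ) (hκ : 0 < κ) (σ : ℂ)
    (hσ : σ = ((2 : ℝ) ^ (-(1 : ℝ) / 6) : ℝ)
        * Complex.exp (3 * Real.pi / 4 * Complex.I) * κ)
    (qh : ℝ → ℂ)
    (hqh : ∀ r : ℝ, qh r = Complex.I * (Real.sqrt (2 / (3 * κ ^ 3)) : ℝ) *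
        ((σ * Complex.exp (σ * r) - Complex.exp (σ * r) / r)
          - ((starRingEnd ℂ) σ * Complex.exp ((starRingEnd ℂ) σ * r)
              - Complex.exp ((starRingEnd ℂ) σ * r) / r))) :
    (∀ r ∈ Set.Ioi (0 : ℝ), (qh r).im = 0) ∧
    (∀ r ∈ Set.Ioi (0 : ℝ),
      Tc (Tc qh) r = -(((2 : ℝ) ^ (-(2 : ℝ) / 3) : ℝ) : ℂ) * (κ : ℂ) ^ 4 * qh r) ∧
    σ ^ 4 = -(((2 : ℝ) ^ (-(2 : ℝ) / 3) : ℝ) : ℂ) * (κ : ℂ) ^ 4 := by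
  have h4 : σ ^ 4 = -(((2 : ℝ) ^ (-(2 : ℝ) / 3) : ℝ) : ℂ) * (κ : ℂ) ^ 4 := by
    have e1 : Complex.exp (3 * Real.pi / 4 * Complex.I) ^ 4 = -1 := by
      rw [← Complex.exp_nat_mul]
      have : ((4 : ℕ) : ℂ) * (3 * Real.pi / 4 * Complex.I)
          = Real.pi * Complex.I + 2 * Real.pi * Complex.I := by push_cast; ring
      rw [this, Complex.exp_add, Complex.exp_pi_mul_I, Complex.exp_two_pi_mul_I, mul_one]
    have e2 : ((2 : ℝ) ^ (-(1 : ℝ) / 6)) ^ 4 = (2 : ℝ) ^ (-(2 : ℝ) / 3) := by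
      rw [← Real.rpow_natCast, ← Real.rpow_mul (by norm_num)]
      norm_num
    rw [hσ, mul_pow, mul_pow, e1, ← e2]
    push_cast
    ring
  have h4' : (starRingEnd ℂ) σ ^ 4 = -(((2 : ℝ) ^ (-(2 : ℝ) / 3) : ℝ) : ℂ) * (κ : ℂ) ^ 4 := by
    rw [← map_pow, h4]
    simp only [map_mul, map_neg, map_pow, Complex.conj_ofReal]
  refine ⟨?_, ?_, h4⟩
  · intro r _
    rw [← Complex.conj_eq_iff_im, hqh]
    simp only [map_mul, map_sub, map_div₀, Complex.conj_ofReal, Complex.conj_I,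
      ← Complex.exp_conj, Complex.conj_conj]
    ring
  · intro r hr
    set c : ℂ := Complex.I * (Real.sqrt (2 / (3 * κ ^ 3)) : ℝ) with hc
    have hq : ∀ r : ℝ, 0 < r → qh r = Gaux c (-c) σ ((starRingEnd ℂ) σ) r := by
      intro r _
      rw [hqh, Gaux]
      ring
    rw [Tc_aux _ _ _ _ _ (Tc_aux _ _ _ _ _ hq) r hr, hq r hr, Gaux, Gaux]
    rw [show -(-(c * σ ^ 2) * σ ^ 2) = c * σ ^ 4 by ring,
      show -(-(-c * (starRingEnd ℂ) σ ^ 2) * (starRingEnd ℂ) σ ^ 2)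
        = -c * (starRingEnd ℂ) σ ^ 4 by ring, h4, h4']
    ring
end

section
/- Fix κ ∈ ℝ and let u be a real-valued function of class C³ on an interval [0, δ) with u(0) = 0 and 3u''(0) = 4κ u'(0). Then lim_{ρ→0⁺} [ 2u(ρ)u'(ρ)/ρ² - 4u(ρ)²/ρ³ - u'(ρ)²/ρ + u'(ρ)u''(ρ) - 2u'(0)u(ρ)/ρ² + 5u'(0)²/ρ ] = -4κ u'(0)². -/
open Filter

/-- Fix `κ ∈ ℝ` and let `u` be real-valued, of class `C³` on `[0, δ)`
(with `δ > 0`), with `u(0) = 0` and `3u''(0) = 4κ u'(0)` (one-sided derivatives at `0`).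
Then, writing `u'`, `u''` for the derivatives within `[0, δ)`,
`lim_{ρ→0⁺} [2u(ρ)u'(ρ)/ρ² - 4u(ρ)²/ρ³ - u'(ρ)²/ρ + u'(ρ)u''(ρ)
  - 2u'(0)u(ρ)/ρ² + 5u'(0)²/ρ] = -4κ u'(0)²`. -/
theorem stmt19 (κ δ : ℝ) (hδ : 0 < δ) (u : ℝ → ℝ)
    (hu : ContDiffOn ℝ 3 u (Set.Ico 0 δ))
    (hu0 : u 0 = 0)
    (hbc : 3 * derivWithin (derivWithin u (Set.Ico 0 δ)) (Set.Ico 0 δ) 0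
        = 4 * κ * derivWithin u (Set.Ico 0 δ) 0) :
    Tendsto (fun ρ : ℝ =>
        2 * u ρ * derivWithin u (Set.Ico 0 δ) ρ / ρ ^ 2
          - 4 * (u ρ) ^ 2 / ρ ^ 3
          - (derivWithin u (Set.Ico 0 δ) ρ) ^ 2 / ρ
          + derivWithin u (Set.Ico 0 δ) ρ
              * derivWithin (derivWithin u (Set.Ico 0 δ)) (Set.Ico 0 δ) ρ
          - 2 * derivWithin u (Set.Ico 0 δ) 0 * u ρ / ρ ^ 2
          + 5 * (derivWithin u (Set.Ico 0 δ) 0) ^ 2 / ρ)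
      (nhdsWithin 0 (Set.Ioi 0))
      (nhds (-4 * κ * (derivWithin u (Set.Ico 0 δ) 0) ^ 2)) := by
  set S := Set.Ico (0:ℝ) δ with hS
  have hUD : UniqueDiffOn ℝ S := uniqueDiffOn_Ico 0 δ
  have h0 : (0:ℝ) ∈ S := ⟨le_refl _, hδ⟩
  set v := derivWithin u S with hv
  have hv2 : ContDiffOn ℝ 2 v S := hu.derivWithin hUD (by norm_num)
  set w := derivWithin v S with hw
  have hw1 : ContDiffOn ℝ 1 w S := hv2.derivWithin hUD (by norm_num)
  have hle : nhdsWithin (0:ℝ) (Set.Ioi 0) ≤ nhdsWithin 0 S := by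
    rw [← nhdsWithin_Ioo_eq_nhdsGT hδ]
    exact nhdsWithin_mono _ Set.Ioo_subset_Ico_self
  have hwt : Tendsto w (nhdsWithin 0 (Set.Ioi 0)) (nhds (w 0)) :=
    (hw1.continuousOn 0 h0).tendsto.mono_left hle
  have hut : Tendsto u (nhdsWithin 0 (Set.Ioi 0)) (nhds 0) := by
    have := (hu.continuousOn 0 h0).tendsto.mono_left hle
    rwa [hu0] at this
  have hid : Tendsto (fun x : ℝ => x) (nhdsWithin 0 (Set.Ioi 0)) (nhds 0) :=
    tendsto_nhdsWithin_of_tendsto_nhds tendsto_id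
  have hp : Tendsto (fun x => (v x - v 0) / x) (nhdsWithin 0 (Set.Ioi 0)) (nhds (w 0)) := by
    have h1 : HasDerivWithinAt v (w 0) S 0 :=
      ((hv2.differentiableOn (by norm_num)) 0 h0).hasDerivWithinAt
    have h2 : HasDerivWithinAt v (w 0) (Set.Ioi 0) 0 := by
      exact (h1.mono Set.Ioo_subset_Ico_self).mono_of_mem_nhdsWithin (Ioo_mem_nhdsGT hδ)
    rw [hasDerivWithinAt_iff_tendsto_slope' (by simp)] at h2
    refine h2.congr fun x => ?_
    simp [slope_def_field]
  have hq : Tendsto (fun x => (u x - v 0 * x) / x ^ 2) (nhdsWithin 0 (Set.Ioi 0))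
      (nhds (w 0 / 2)) := by
    have hmem : Set.Ioo (0:ℝ) δ ∈ nhdsWithin (0:ℝ) (Set.Ioi 0) := Ioo_mem_nhdsGT hδ
    refine HasDerivAt.lhopital_zero_nhdsGT (f' := fun x => v x - v 0) (g' := fun x => 2 * x)
      ?_ ?_ ?_ ?_ ?_ ?_
    · filter_upwards [hmem] with x hx
      have hxS : S ∈ nhds x := Ico_mem_nhds hx.1 hx.2
      have h1 : HasDerivAt u (v x) x :=
        ((hu.differentiableOn (by norm_num)) x
          (Set.Ioo_subset_Ico_self hx)).hasDerivWithinAt.hasDerivAt hxS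
      have h2 := h1.sub ((hasDerivAt_id x).const_mul (v 0))
      rw [mul_one] at h2
      exact h2
    · filter_upwards with x
      simpa using hasDerivAt_pow 2 x
    · filter_upwards [self_mem_nhdsWithin] with x hx
      have : (0:ℝ) < x := hx
      positivity
    · simpa using hut.sub (hid.const_mul (v 0))
    · simpa using hid.pow 2
    · refine (hp.div_const 2).congr fun x => ?_
      rw [div_div, mul_comm]
  set p := fun x => (v x - v 0) / x with hpd
  set q := fun x => (u x - v 0 * x) / x ^ 2 with hqd
  have key : Tendsto (fun x => 2 * v 0 * (p x + q x) + 2 * p x * q x * x - 8 * v 0 * q x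
      - 4 * q x ^ 2 * x - 2 * v 0 * p x - p x ^ 2 * x + (v 0 + p x * x) * w x - 2 * v 0 * q x)
      (nhdsWithin 0 (Set.Ioi 0))
      (nhds (2 * v 0 * (w 0 + w 0 / 2) + 2 * w 0 * (w 0 / 2) * 0 - 8 * v 0 * (w 0 / 2)
      - 4 * (w 0 / 2) ^ 2 * 0 - 2 * v 0 * w 0 - w 0 ^ 2 * 0 + (v 0 + w 0 * 0) * w 0
      - 2 * v 0 * (w 0 / 2))) :=
    (((((((((hp.add hq).const_mul (2 * v 0)).add (((hp.const_mul 2).mul hq).mul hid)).sub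
      (hq.const_mul (8 * v 0))).sub (((hq.pow 2).const_mul 4).mul hid)).sub
      (hp.const_mul (2 * v 0))).sub ((hp.pow 2).mul hid)).add
      (((hp.mul hid).const_add (v 0)).mul hwt)).sub (hq.const_mul (2 * v 0)))
  have hlim : -4 * κ * v 0 ^ 2 = 2 * v 0 * (w 0 + w 0 / 2) + 2 * w 0 * (w 0 / 2) * 0
      - 8 * v 0 * (w 0 / 2)
      - 4 * (w 0 / 2) ^ 2 * 0 - 2 * v 0 * w 0 - w 0 ^ 2 * 0 + (v 0 + w 0 * 0) * w 0
      - 2 * v 0 * (w 0 / 2) := by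
    linear_combination (v 0) * hbc
  rw [hlim]
  refine key.congr' ?_
  filter_upwards [self_mem_nhdsWithin] with x hx
  have hx0 : x ≠ 0 := ne_of_gt hx
  have e1 : v x = v 0 + p x * x := by simp only [hpd]; field_simp; ring
  have e2 : u x = v 0 * x + q x * x ^ 2 := by simp only [hqd]; field_simp; ring
  rw [e1, e2]
  clear_value p q
  field_simp
  ring
end
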